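/- For all homogeneous f, g, h in W, the Gerstenhaber bracket satisfies the graded Jacobi identity [[f,g],h] = [f,[g,h]] − (−1)^{|f||g|}[g,[f,h]]; together with the graded skew-symmetry [f,g] = −(−1)^{|f||g|}[g,f], this makes W a graded Lie algebra. -/

import Mathlib

/-!
Statement 0: the Gerstenhaber bracket on `W = ⊕ₙ Hom(V^{⊗n}, V)` satisfies the graded
Jacobi identity and graded skew-symmetry, making `W` a graded Lie algebra.

A homogeneous element of `W` of internal degree `d` is encoded by its values on lists of
homogeneous elements of `V` (with multilinearity stated as a predicate).
-/

namespace Ainf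

variable (k : Type*) [Field k] [CharZero k]
variable (V : ℤ → Type*) [∀ l, AddCommGroup (V l)] [∀ l, Module k (V l)]

/-- Homogeneous elements of `V`, tagged with their degree. -/
abbrev HV := Σ l : ℤ, V l

/-- Total degree of a list of homogeneous elements. -/
def degSum (vs : List (HV V)) : ℤ := (vs.map Sigma.fst).sum

/-- Cast between homogeneous components (junk value `0` if the degrees differ;
in all intended uses the degrees provably agree). -/
def vcast {a b : ℤ} (x : V a) : V b := if h : a = b then h ▸ x else 0

/-- A homogeneous degree-`d` element of `Hom(T(V),V)`, encoded by its values on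
tuples (lists) of homogeneous elements of `V`. -/
abbrev E (d : ℤ) := (vs : List (HV V)) → V (d + degSum V vs)

/-- Multilinearity (over `k`, in each slot) of a graded map: this singles out the
elements of `W = Hom(T(V),V)` among all functions on homogeneous tuples. -/
def IsMultilinear {d : ℤ} (f : E V d) : Prop :=
  (∀ (xs zs : List (HV V)) (l : ℤ) (x y : V l),
      (vcast V (f (xs ++ ⟨l, x + y⟩ :: zs)) : V (d + degSum V xs + l + degSum V zs)) =
        vcast V (f (xs ++ ⟨l, x⟩ :: zs)) + vcast V (f (xs ++ ⟨l, y⟩ :: zs))) ∧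
  (∀ (xs zs : List (HV V)) (l : ℤ) (c : k) (x : V l),
      (vcast V (f (xs ++ ⟨l, c • x⟩ :: zs)) : V (d + degSum V xs + l + degSum V zs)) =
        c • vcast V (f (xs ++ ⟨l, x⟩ :: zs)))

/-- All splittings of a list into two consecutive parts. -/
def splits2 {α : Type*} (vs : List α) : List (List α × List α) :=
  (List.range (vs.length + 1)).map fun i => (vs.take i, vs.drop i)

/-- All splittings of a list into three consecutive parts. -/
def splits3 {α : Type*} (vs : List α) : List (List α × List α × List α) :=
  (splits2 vs).flatMap fun p => (splits2 p.2).map fun q => (p.1, q.1, q.2)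

/-- The Gerstenhaber composition product
`(f∘g)(v₁,…) = Σᵢ (−1)^{|g|(|v₁|+⋯+|vᵢ|)} f(v₁,…,vᵢ,g(v_{i+1},…),…)`. -/
def gcomp {a b : ℤ} (f : E V a) (g : E V b) : E V (a + b) := fun vs =>
  ((splits3 vs).map fun p =>
    ((-1 : k) ^ (b * degSum V p.1)) •
      vcast V (f (p.1 ++ ⟨b + degSum V p.2.1, g p.2.1⟩ :: p.2.2))).sum

/-- Degree recast of a graded map (junk when the degrees differ). -/
def recast {a b : ℤ} (f : E V a) : E V b := fun vs => vcast V (f vs)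

/-- The Gerstenhaber bracket `[f,g] = f∘g − (−1)^{|f||g|} g∘f`. -/
def gbr {a b : ℤ} (f : E V a) (g : E V b) : E V (a + b) :=
  gcomp k V f g - ((-1 : k) ^ (a * b)) • recast V (gcomp k V g f)

set_option linter.unusedSectionVars false

/-- The sum of `φ p r` over all splittings `vs = p ++ r`. -/
def splitSum {α M : Type*} [AddCommMonoid M] (vs : List α) (φ : List α → List α → M) : M :=
  ((splits2 vs).map fun p => φ p.1 p.2).sum

section SplitSum

variable {α M : Type*} [AddCommMonoid M]

lemma splitSum_nil (φ : List α → List α → M) : splitSum [] φ = φ [] [] := by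
  simp [splitSum, splits2]

lemma splitSum_cons (x : α) (vs : List α) (φ : List α → List α → M) :
    splitSum (x :: vs) φ = φ [] (x :: vs) + splitSum vs fun p r => φ (x :: p) r := by
  simp [splitSum, splits2, List.range_succ_eq_map, Function.comp_def]

lemma splitSum_congr {vs : List α} {φ ψ : List α → List α → M}
    (h : ∀ p r, p ++ r = vs → φ p r = ψ p r) : splitSum vs φ = splitSum vs ψ := by
  unfold splitSum splits2
  congr 1
  simp only [List.map_map]
  exact List.map_congr_left fun i _ => h _ _ (List.take_append_drop i vs)

lemma splitSum_add (vs : List α) (φ ψ : List α → List α → M) :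
    (splitSum vs fun p r => φ p r + ψ p r) = splitSum vs φ + splitSum vs ψ := by
  simp [splitSum, List.sum_map_add]

lemma map_splitSum {N G : Type*} [AddCommMonoid N] [FunLike G M N] [AddMonoidHomClass G M N]
    (L : G) (vs : List α) (φ : List α → List α → M) :
    L (splitSum vs φ) = splitSum vs fun p r => L (φ p r) := by
  simp [splitSum, map_list_sum, Function.comp_def]

lemma smul_splitSum {R : Type*} [Semiring R] [Module R M] (c : R) (vs : List α)
    (φ : List α → List α → M) :
    c • splitSum vs φ = splitSum vs fun p r => c • φ p r :=
  map_splitSum (DistribSMul.toAddMonoidHom M c) vs φ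

lemma splitSum_comm {β : Type*} (vs : List α) (ws : List β)
    (φ : List α → List α → List β → List β → M) :
    (splitSum vs fun p r => splitSum ws fun q s => φ p r q s) =
      splitSum ws fun q s => splitSum vs fun p r => φ p r q s := by
  induction vs generalizing φ with
  | nil => simp [splitSum_nil]
  | cons x vs ih => simp [splitSum_cons, splitSum_add, ih]

lemma splitSum_append_cons (p : List α) (x : α) (r : List α) (φ : List α → List α → M) :
    splitSum (p ++ x :: r) φ =
      (splitSum p fun a b => φ a (b ++ x :: r)) + splitSum r fun a b => φ (p ++ x :: a) b := by
  induction p generalizing φ with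
  | nil => simp [splitSum_nil, splitSum_cons]
  | cons y p ih => simp [splitSum_cons, ih, add_assoc]

lemma splitSum_assoc (vs : List α) (φ : List α → List α → List α → M) :
    (splitSum vs fun p q => splitSum p fun a b => φ a b q) =
      splitSum vs fun a q => splitSum q fun b c => φ a b c := by
  induction vs generalizing φ with
  | nil => simp [splitSum_nil]
  | cons x vs ih => simp [splitSum_cons, splitSum_add, ih, add_assoc, splitSum_nil]

lemma splitSum_split_left (vs : List α)
    (φ : List α → List α → List α → List α → List α → M) :
    (splitSum vs fun p m => splitSum m fun q r => splitSum p fun u b => splitSum b fun s t =>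
      φ u s t q r) =
    splitSum vs fun u m₁ => splitSum m₁ fun s m₂ => splitSum m₂ fun t m₃ =>
      splitSum m₃ fun q r => φ u s t q r := by
  have hcomm : ∀ p m : List α,
      (splitSum m fun q r => splitSum p fun u b => splitSum b fun s t => φ u s t q r) =
        splitSum p fun u b => splitSum b fun s t => splitSum m fun q r => φ u s t q r := by
    intro p m
    rw [splitSum_comm]
    exact splitSum_congr fun u b _ => splitSum_comm _ _ _
  simp only [hcomm]
  rw [splitSum_assoc vs fun u b m => splitSum b fun s t => splitSum m fun q r => φ u s t q r]
  exact splitSum_congr fun u x _ =>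
    splitSum_assoc x fun s t m => splitSum m fun q r => φ u s t q r

lemma splitSum_split_outer (vs : List α)
    (φ : List α → List α → List α → List α → List α → M) :
    (splitSum vs fun p m => splitSum m fun q r => splitSum p fun u s => splitSum r fun t z =>
      φ u s q t z) =
    splitSum vs fun u m₁ => splitSum m₁ fun s m₂ => splitSum m₂ fun q m₃ =>
      splitSum m₃ fun t z => φ u s q t z := by
  simp only [splitSum_comm (M := M) _ _ fun q r u s => splitSum r fun t z => φ u s q t z]
  exact splitSum_assoc vs fun u s m => splitSum m fun q r => splitSum r fun t z => φ u s q t z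

lemma sum_map_splits3 (vs : List α) (φ : List α × List α × List α → M) :
    ((splits3 vs).map φ).sum = splitSum vs fun p m => splitSum m fun q r => φ (p, q, r) := by
  simp [splits3, splitSum, List.flatMap, List.map_flatten, List.sum_flatten, Function.comp_def]

end SplitSum

lemma degSum_append (vs ws : List (HV V)) :
    degSum V (vs ++ ws) = degSum V vs + degSum V ws := by
  simp [degSum]

lemma degSum_cons (x : HV V) (vs : List (HV V)) :
    degSum V (x :: vs) = x.1 + degSum V vs := by
  simp [degSum]

lemma lof_vcast {m n : ℤ} (h : m = n) (x : V m) :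
    DirectSum.lof k ℤ V n (vcast V x) = DirectSum.lof k ℤ V m x := by
  subst h; simp [vcast]

lemma sigma_vcast {m n : ℤ} (h : m = n) (x : V m) :
    (⟨n, vcast V x⟩ : HV V) = ⟨m, x⟩ := by
  subst h; simp [vcast]

/-- The value of `f` at `vs`, as an element of the total space `⨁ l, V l`. -/
def totalValue {d : ℤ} (f : E V d) (vs : List (HV V)) : DirectSum ℤ V :=
  DirectSum.lof k ℤ V _ (f vs)

/-- The value of `f` at `vs`, as a homogeneous element tagged with its degree. -/
def taggedValue {d : ℤ} (f : E V d) (vs : List (HV V)) : HV V := ⟨d + degSum V vs, f vs⟩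

lemma totalValue_injective {d : ℤ} {f g : E V d}
    (h : ∀ vs, totalValue k V f vs = totalValue k V g vs) : f = g := by
  funext vs
  exact DirectSum.of_injective (β := V) _ (h vs)

lemma totalValue_sub {d : ℤ} (f g : E V d) (vs : List (HV V)) :
    totalValue k V (f - g) vs = totalValue k V f vs - totalValue k V g vs :=
  map_sub (DirectSum.lof k ℤ V _) _ _

lemma totalValue_smul {d : ℤ} (c : k) (f : E V d) (vs : List (HV V)) :
    totalValue k V (c • f) vs = c • totalValue k V f vs :=
  map_smul (DirectSum.lof k ℤ V _) _ _

lemma totalValue_recast {d e : ℤ} (h : d = e) (f : E V d) (vs : List (HV V)) :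
    totalValue k V (recast V f : E V e) vs = totalValue k V f vs :=
  lof_vcast k V (by rw [h]) _

lemma recast_self {d : ℤ} (f : E V d) : (recast V f : E V d) = f := by
  funext vs; simp [recast, vcast]

/-- A multilinear `f`, as a linear map in a single slot. -/
def slotMap {d : ℤ} (f : E V d) (hf : IsMultilinear k V f) (xs zs : List (HV V)) (l : ℤ) :
    V l →ₗ[k] DirectSum ℤ V where
  toFun x := totalValue k V f (xs ++ ⟨l, x⟩ :: zs)
  map_add' x y := by
    have h := congrArg (DirectSum.lof k ℤ V _) (hf.1 xs zs l x y)
    rw [map_add] at h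
    iterate 3 rw [lof_vcast k V (by simp [degSum_append, degSum_cons]; ring)] at h
    exact h
  map_smul' c x := by
    have h := congrArg (DirectSum.lof k ℤ V _) (hf.2 xs zs l c x)
    rw [map_smul] at h
    iterate 2 rw [lof_vcast k V (by simp [degSum_append, degSum_cons]; ring)] at h
    exact h

lemma gcomp_apply {a b : ℤ} (f : E V a) (g : E V b) (vs : List (HV V)) :
    gcomp k V f g vs = splitSum vs fun p m => splitSum m fun q r =>
      ((-1 : k) ^ (b * degSum V p)) • vcast V (f (p ++ taggedValue V g q :: r)) :=
  sum_map_splits3 _ _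

lemma totalValue_gcomp {a b : ℤ} (f : E V a) (g : E V b) (vs : List (HV V)) :
    totalValue k V (gcomp k V f g) vs = splitSum vs fun p m => splitSum m fun q r =>
      ((-1 : k) ^ (b * degSum V p)) • totalValue k V f (p ++ taggedValue V g q :: r) := by
  rw [totalValue, gcomp_apply, map_splitSum]
  refine splitSum_congr fun p m hpm => ?_
  rw [map_splitSum]
  refine splitSum_congr fun q r hqr => ?_
  subst hqr hpm
  rw [map_smul, lof_vcast, totalValue]
  simp only [degSum_append, degSum_cons, taggedValue]
  ring

lemma totalValue_taggedValue_gcomp {a b c : ℤ} (f : E V a) (hf : IsMultilinear k V f)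
    (g : E V b) (h : E V c) (xs zs vs : List (HV V)) :
    totalValue k V f (xs ++ taggedValue V (gcomp k V g h) vs :: zs) =
      splitSum vs fun p m => splitSum m fun q r => ((-1 : k) ^ (c * degSum V p)) •
        totalValue k V f (xs ++ taggedValue V g (p ++ taggedValue V h q :: r) :: zs) := by
  change slotMap k V f hf xs zs _ (gcomp k V g h vs) = _
  rw [gcomp_apply, map_splitSum]
  refine splitSum_congr fun p m hpm => ?_
  rw [map_splitSum]
  refine splitSum_congr fun q r hqr => ?_
  subst hqr hpm
  rw [map_smul]
  congr 1
  change totalValue k V f (xs ++ ⟨_, vcast V _⟩ :: zs) = _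
  rw [sigma_vcast]
  · rfl
  simp only [degSum_append, degSum_cons, taggedValue]
  ring

lemma gcomp_sub_smul_left {a b : ℤ} (c : k) (f f' : E V a) (g : E V b) :
    gcomp k V (f - c • f') g = gcomp k V f g - c • gcomp k V f' g := by
  refine totalValue_injective k V fun vs => ?_
  rw [totalValue_sub, totalValue_smul, eq_sub_iff_add_eq]
  simp only [totalValue_gcomp, smul_splitSum, ← splitSum_add, totalValue_sub, totalValue_smul]
  refine splitSum_congr fun p m _ => splitSum_congr fun q r _ => ?_
  module

lemma gcomp_sub_smul_right {a b : ℤ} (c : k) (f : E V a) (hf : IsMultilinear k V f)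
    (g g' : E V b) :
    gcomp k V f (g - c • g') = gcomp k V f g - c • gcomp k V f g' := by
  refine totalValue_injective k V fun vs => ?_
  rw [totalValue_sub, totalValue_smul, eq_sub_iff_add_eq]
  simp only [totalValue_gcomp, smul_splitSum, ← splitSum_add]
  refine splitSum_congr fun p m _ => splitSum_congr fun q r _ => ?_
  have h : totalValue k V f (p ++ taggedValue V (g - c • g') q :: r) =
      totalValue k V f (p ++ taggedValue V g q :: r) -
        c • totalValue k V f (p ++ taggedValue V g' q :: r) := by
    change slotMap k V f hf p r _ (g q - c • g' q) = _
    rw [map_sub, map_smul]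
    rfl
  rw [h]
  module

lemma totalValue_gcomp_recast_left {a a' b : ℤ} (h : a = a') (f : E V a) (g : E V b)
    (vs : List (HV V)) :
    totalValue k V (gcomp k V (recast V f : E V a') g) vs = totalValue k V (gcomp k V f g) vs := by
  subst h; rw [recast_self]

lemma totalValue_gcomp_recast_right {a b b' : ℤ} (h : b = b') (f : E V a) (g : E V b)
    (vs : List (HV V)) :
    totalValue k V (gcomp k V f (recast V g : E V b')) vs = totalValue k V (gcomp k V f g) vs := by
  subst h; rw [recast_self]

/-- The sum of `± f(…, g(…), …, h(…), …)` over all ways of inserting `g` and `h` into separate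
slots of `f`, with `g` to the left of `h`. -/
def insertTwo {a b c : ℤ} (f : E V a) (g : E V b) (h : E V c) (vs : List (HV V)) :
    DirectSum ℤ V :=
  splitSum vs fun u m₁ => splitSum m₁ fun p m₂ => splitSum m₂ fun v m₃ => splitSum m₃ fun q w =>
    ((-1 : k) ^ (b * degSum V u + c * (degSum V u + degSum V p + degSum V v))) •
      totalValue k V f (u ++ taggedValue V g p :: (v ++ taggedValue V h q :: w))

lemma totalValue_gcomp_gcomp_right {a b c : ℤ} (f : E V a) (hf : IsMultilinear k V f)
    (g : E V b) (h : E V c) (vs : List (HV V)) :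
    totalValue k V (gcomp k V f (gcomp k V g h)) vs =
      splitSum vs fun u m₁ => splitSum m₁ fun v m₂ => splitSum m₂ fun q m₃ =>
        splitSum m₃ fun w z =>
          ((-1 : k) ^ ((b + c) * degSum V u + c * degSum V v)) •
            totalValue k V f (u ++ taggedValue V g (v ++ taggedValue V h q :: w) :: z) := by
  simp only [totalValue_gcomp k V f, totalValue_taggedValue_gcomp k V f hf, smul_splitSum,
    smul_smul, ← zpow_add₀ (neg_ne_zero.mpr (one_ne_zero (α := k)))]
  refine splitSum_congr fun u m₁ _ => ?_
  rw [splitSum_assoc m₁ fun v n z => splitSum n fun q w =>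
    ((-1 : k) ^ ((b + c) * degSum V u + c * degSum V v)) •
      totalValue k V f (u ++ taggedValue V g (v ++ taggedValue V h q :: w) :: z)]
  refine splitSum_congr fun v m₂ _ => ?_
  exact splitSum_assoc m₂ _

lemma totalValue_gcomp_gcomp_left {a b c : ℤ} (f : E V a) (hf : IsMultilinear k V f)
    (g : E V b) (h : E V c) (vs : List (HV V)) :
    totalValue k V (gcomp k V (gcomp k V f g) h) vs =
      totalValue k V (gcomp k V f (gcomp k V g h)) vs + insertTwo k V f g h vs +
        ((-1 : k) ^ (b * c)) • insertTwo k V f h g vs := by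
  have h0 : (-1 : k) ≠ 0 := neg_ne_zero.mpr one_ne_zero
  rw [totalValue_gcomp_gcomp_right k V f hf]
  simp only [totalValue_gcomp, smul_splitSum, smul_smul, ← zpow_add₀ h0, splitSum_append_cons,
    splitSum_add, smul_add, insertTwo, List.append_assoc, List.cons_append]
  rw [add_comm (splitSum vs _)]
  refine congrArg₂ _ (congrArg₂ _ ?_ ?_) ?_
  · rw [← splitSum_split_outer vs fun u v q w z =>
      ((-1 : k) ^ ((b + c) * degSum V u + c * degSum V v)) •
        totalValue k V f (u ++ taggedValue V g (v ++ taggedValue V h q :: w) :: z)]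
    refine splitSum_congr fun p m _ => splitSum_congr fun q r _ => splitSum_congr fun u v huv =>
      splitSum_congr fun w z _ => ?_
    congr 2
    rw [← huv, degSum_append]
    ring
  · rw [← splitSum_split_left vs fun u p v q w =>
      ((-1 : k) ^ (b * degSum V u + c * (degSum V u + degSum V p + degSum V v))) •
        totalValue k V f (u ++ taggedValue V g p :: (v ++ taggedValue V h q :: w))]
    refine splitSum_congr fun p m _ => splitSum_congr fun q r _ => splitSum_congr fun u s hus =>
      splitSum_congr fun t w hst => ?_
    congr 2
    rw [← hus, ← hst, degSum_append, degSum_append]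
    ring
  · refine splitSum_congr fun p m _ => splitSum_congr fun q r _ => splitSum_congr fun u s _ =>
      splitSum_congr fun t w _ => ?_
    rw [degSum_append, degSum_cons, taggedValue,
      show c * degSum V p + b * (degSum V p + (c + degSum V q + degSum V u)) =
        b * c + (c * degSum V p + b * (degSum V p + degSum V q + degSum V u)) by ring]

lemma neg_one_zpow_eq_or (n : ℤ) : (-1 : k) ^ n = 1 ∨ (-1 : k) ^ n = -1 :=
  mul_self_eq_one_iff.mp (by rw [← mul_zpow]; simp)

lemma totalValue_associator_symm {a b c : ℤ} (f : E V a) (hf : IsMultilinear k V f)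
    (g : E V b) (h : E V c) (vs : List (HV V)) :
    totalValue k V (gcomp k V (gcomp k V f g) h) vs =
      totalValue k V (gcomp k V f (gcomp k V g h)) vs +
        ((-1 : k) ^ (b * c)) • (totalValue k V (gcomp k V (gcomp k V f h) g) vs -
          totalValue k V (gcomp k V f (gcomp k V h g)) vs) := by
  rw [totalValue_gcomp_gcomp_left k V f hf g h, totalValue_gcomp_gcomp_left k V f hf h g,
    mul_comm c b]
  rcases neg_one_zpow_eq_or k (b * c) with hbc | hbc <;>
  · rw [hbc]
    module

/-- For all homogeneous `f, g, h ∈ W` the Gerstenhaber bracket satisfies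
the graded Jacobi identity `[[f,g],h] = [f,[g,h]] − (−1)^{|f||g|}[g,[f,h]]` and the graded
skew-symmetry `[f,g] = −(−1)^{|f||g|}[g,f]`. -/
theorem gerstenhaber_bracket_graded_Jacobi_and_skew
    (a b c : ℤ) (f : E V a) (g : E V b) (h : E V c)
    (hf : IsMultilinear k V f) (hg : IsMultilinear k V g) (hh : IsMultilinear k V h) :
    gbr k V (gbr k V f g) h =
      recast V (gbr k V f (gbr k V g h)) -
        ((-1 : k) ^ (a * b)) • recast V (gbr k V g (gbr k V f h)) ∧
    gbr k V f g = (-((-1 : k) ^ (a * b))) • recast V (gbr k V g f) := by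
  constructor
  · refine totalValue_injective k V fun vs => ?_
    have hfgh := totalValue_associator_symm k V f hf g h vs
    have hgfh := totalValue_associator_symm k V g hg f h vs
    have hhfg := totalValue_associator_symm k V h hh f g vs
    simp only [gbr, gcomp_sub_smul_left, gcomp_sub_smul_right k V _ f hf,
      gcomp_sub_smul_right k V _ g hg, gcomp_sub_smul_right k V _ h hh, totalValue_sub,
      totalValue_smul, totalValue_recast k V (show a + (b + c) = a + b + c by ring),
      totalValue_recast k V (show b + (a + c) = a + b + c by ring),
      totalValue_recast k V (show c + (a + b) = a + b + c by ring),
      totalValue_recast k V (show b + c + a = a + (b + c) by ring),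
      totalValue_recast k V (show a + c + b = b + (a + c) by ring),
      totalValue_gcomp_recast_left k V (add_comm b a),
      totalValue_gcomp_recast_left k V (add_comm c a),
      totalValue_gcomp_recast_left k V (add_comm c b),
      totalValue_gcomp_recast_right k V (add_comm b a),
      totalValue_gcomp_recast_right k V (add_comm c a),
      totalValue_gcomp_recast_right k V (add_comm c b)]
    have h0 : (-1 : k) ≠ 0 := neg_ne_zero.mpr one_ne_zero
    rw [hfgh, hgfh, hhfg]
    simp only [add_mul, mul_add, zpow_add₀ h0, mul_comm b a]
    rcases neg_one_zpow_eq_or k (a * b) with hab | hab <;>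
    rcases neg_one_zpow_eq_or k (a * c) with hac | hac <;>
    rcases neg_one_zpow_eq_or k (b * c) with hbc | hbc <;>
    · rw [hab, hac, hbc]
      module
  · refine totalValue_injective k V fun vs => ?_
    simp only [gbr, totalValue_sub, totalValue_smul, totalValue_recast k V (add_comm b a),
      totalValue_recast k V (add_comm a b), mul_comm b a]
    rcases neg_one_zpow_eq_or k (a * b) with hab | hab <;>
    · rw [hab]
      module

end Ainf
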